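/- arXiv:1606.00963 — 3 statements merged into one kernel-verified Lean document; each statement's English description precedes it below -/
import Mathlib

section
/- The first marginal P₁ = P ∘ π₁⁻¹ of P, where π₁(x₁,x₂) = x₁, satisfies P₁ = (1/5)·P₁∘T₁⁻¹ + (1/5)·P₁∘T₂⁻¹ + (3/5)·P₁∘T₃⁻¹, where T₁, T₂, T₃ : ℝ → ℝ are given by T₁(t) = t/4, T₂(t) = t/4 + 3/4, T₃(t) = t/2 + 1/4. -/
open MeasureTheory Real Set
open scoped ENNReal NNReal

/-- The three contractive similarities generating the nonhomogeneous R-triangle.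
Letters 1,2,3 of the paper correspond to `0,1,2 : Fin 3`. -/
noncomputable def Smap : Fin 3 → ℝ × ℝ → ℝ × ℝ :=
  ![fun x => (x.1 / 4, x.2 / 4),
    fun x => (x.1 / 4 + 3 / 4, x.2 / 4),
    fun x => (x.1 / 2 + 1 / 4, x.2 / 2 + Real.sqrt 3 / 4)]

/-- `Sw ω = S_{ω₁} ∘ ⋯ ∘ S_{ω_k}` for a word `ω = ω₁⋯ω_k`. -/
noncomputable def Sw (ω : List (Fin 3)) : ℝ × ℝ → ℝ × ℝ :=
  (ω.map Smap).foldr (· ∘ ·) id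

/-- The probability weights `p₁ = p₂ = 1/5`, `p₃ = 3/5`. -/
noncomputable def pr : Fin 3 → ℝ := ![1/5, 1/5, 3/5]

/-- The similarity ratios `s₁ = s₂ = 1/4`, `s₃ = 1/2`. -/
noncomputable def sr : Fin 3 → ℝ := ![1/4, 1/4, 1/2]

/-- `p_ω = p_{ω₁}⋯p_{ω_k}`. -/
noncomputable def pw (ω : List (Fin 3)) : ℝ := (ω.map pr).prod

/-- `s_ω = s_{ω₁}⋯s_{ω_k}`. -/
noncomputable def sw (ω : List (Fin 3)) : ℝ := (ω.map sr).prod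

/-- `P` is the nonhomogeneous R-measure:
`P = (1/5)·P∘S₁⁻¹ + (1/5)·P∘S₂⁻¹ + (3/5)·P∘S₃⁻¹`. -/
def IsRMeasure (P : Measure (ℝ × ℝ)) : Prop :=
  P = (1/5 : ℝ≥0∞) • P.map (Smap 0) + (1/5 : ℝ≥0∞) • P.map (Smap 1)
        + (3/5 : ℝ≥0∞) • P.map (Smap 2)

/-- The closed equilateral triangle with vertices (0,0), (1,0), (1/2, √3/2). -/
noncomputable def Δtri : Set (ℝ × ℝ) :=
  convexHull ℝ ({(0, 0), (1, 0), (1/2, Real.sqrt 3 / 2)} : Set (ℝ × ℝ))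

/-- Squared Euclidean distance on ℝ². -/
def sqDist (x a : ℝ × ℝ) : ℝ := (x.1 - a.1) ^ 2 + (x.2 - a.2) ^ 2

/-- If `f : ℝ × ℝ → ℝ × ℝ` covers `T : ℝ → ℝ` on first coordinates, then the first marginal of
the image of `P` under `f` is the image of the first marginal of `P` under `T`. -/
theorem map_fst_map_of_semiconj {P : Measure (ℝ × ℝ)} {f : ℝ × ℝ → ℝ × ℝ} {T : ℝ → ℝ}
    (hf : Measurable f) (hT : Measurable T) (h : Function.Semiconj Prod.fst f T) :
    (P.map f).map Prod.fst = (P.map Prod.fst).map T := by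
  rw [Measure.map_map measurable_fst hf, Measure.map_map hT measurable_fst, h.comp_eq]

/-- The first marginal `P₁ = P ∘ π₁⁻¹` satisfies
`P₁ = (1/5)·P₁∘T₁⁻¹ + (1/5)·P₁∘T₂⁻¹ + (3/5)·P₁∘T₃⁻¹` with
`T₁(t) = t/4`, `T₂(t) = t/4 + 3/4`, `T₃(t) = t/2 + 1/4`. -/
theorem stmt_1 (P : Measure (ℝ × ℝ)) [IsProbabilityMeasure P] (hP : IsRMeasure P) :
    P.map Prod.fst =
      (1/5 : ℝ≥0∞) • (P.map Prod.fst).map (fun t : ℝ => t / 4)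
      + (1/5 : ℝ≥0∞) • (P.map Prod.fst).map (fun t : ℝ => t / 4 + 3 / 4)
      + (3/5 : ℝ≥0∞) • (P.map Prod.fst).map (fun t : ℝ => t / 2 + 1 / 4) := by
  have h0 : Measurable (Smap 0) := by
    change Measurable fun x : ℝ × ℝ => (x.1 / 4, x.2 / 4)
    fun_prop
  have h1 : Measurable (Smap 1) := by
    change Measurable fun x : ℝ × ℝ => (x.1 / 4 + 3 / 4, x.2 / 4)
    fun_prop
  have h2 : Measurable (Smap 2) := by
    change Measurable fun x : ℝ × ℝ => (x.1 / 2 + 1 / 4, x.2 / 2 + Real.sqrt 3 / 4)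
    fun_prop
  have hmap := congrArg (Measure.map Prod.fst) hP
  rw [Measure.map_add _ _ measurable_fst, Measure.map_add _ _ measurable_fst,
    Measure.map_smul, Measure.map_smul, Measure.map_smul,
    map_fst_map_of_semiconj (T := fun t => t / 4) h0 (by fun_prop) fun _ => rfl,
    map_fst_map_of_semiconj (T := fun t => t / 4 + 3 / 4) h1 (by fun_prop) fun _ => rfl,
    map_fst_map_of_semiconj (T := fun t => t / 2 + 1 / 4) h2 (by fun_prop) fun _ => rfl] at hmap
  exact hmap
end

section
/- The expected value of the random vector X = (X₁, X₂) with distribution P is E(X) = (1/2, √3/4), i.e., ∫ x₁ dP(x₁,x₂) = 1/2 and ∫ x₂ dP(x₁,x₂) = √3/4. -/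
open MeasureTheory Real Set
open scoped ENNReal NNReal

theorem continuous_Smap (i : Fin 3) : Continuous (Smap i) := by
  fin_cases i <;> simp only [Smap] <;> dsimp <;> fun_prop

theorem norm_Smap_le (i : Fin 3) (x : ℝ × ℝ) : ‖Smap i x‖ ≤ ‖x‖ / 2 + 3 / 4 := by
  have h1 : |x.1| ≤ ‖x‖ := norm_fst_le x
  have h2 : |x.2| ≤ ‖x‖ := norm_snd_le x
  have h4 : Real.sqrt 3 ≤ 3 := Real.sqrt_le_iff.2 (by norm_num)
  have h5 := Real.sqrt_nonneg 3
  rw [abs_le] at h1 h2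
  rw [norm_prod_le_iff, Real.norm_eq_abs, Real.norm_eq_abs, abs_le, abs_le]
  fin_cases i <;> simp [Smap] <;> refine ⟨⟨?_, ?_⟩, ?_, ?_⟩ <;> linarith

/-- The mass outside a ball of radius `3/2 + e` does not increase when `e` is replaced
by `2 * e`. -/
theorem IsRMeasure.measure_norm_gt_le {P : Measure (ℝ × ℝ)} (hP : IsRMeasure P) (e : ℝ) :
    P {x | 3 / 2 + e < ‖x‖} ≤ P {x | 3 / 2 + 2 * e < ‖x‖} := by
  have hm : MeasurableSet {x : ℝ × ℝ | 3 / 2 + e < ‖x‖} :=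
    measurableSet_lt measurable_const measurable_norm
  have key (i : Fin 3) :
      P.map (Smap i) {x | 3 / 2 + e < ‖x‖} ≤ P {x | 3 / 2 + 2 * e < ‖x‖} := by
    rw [Measure.map_apply (continuous_Smap i).measurable hm]
    refine measure_mono fun x hx => ?_
    have := norm_Smap_le i x
    simp only [mem_preimage, mem_ofPred_eq] at hx ⊢
    linarith
  have hsum : (1 / 5 + 1 / 5 + 3 / 5 : ℝ≥0∞) = 1 := by
    rw [ENNReal.div_add_div_same, ENNReal.div_add_div_same]
    norm_num
    exact ENNReal.div_self (by norm_num) (by norm_num)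
  calc P {x | 3 / 2 + e < ‖x‖}
      = 1 / 5 * P.map (Smap 0) {x | 3 / 2 + e < ‖x‖}
        + 1 / 5 * P.map (Smap 1) {x | 3 / 2 + e < ‖x‖}
        + 3 / 5 * P.map (Smap 2) {x | 3 / 2 + e < ‖x‖} :=
        congrArg (fun μ : Measure (ℝ × ℝ) => μ {x | 3 / 2 + e < ‖x‖}) hP
    _ ≤ 1 / 5 * P {x | 3 / 2 + 2 * e < ‖x‖} + 1 / 5 * P {x | 3 / 2 + 2 * e < ‖x‖}
        + 3 / 5 * P {x | 3 / 2 + 2 * e < ‖x‖} := by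
        exact add_le_add (add_le_add (mul_le_mul_right (key 0) _) (mul_le_mul_right (key 1) _))
          (mul_le_mul_right (key 2) _)
    _ = P {x | 3 / 2 + 2 * e < ‖x‖} := by
        rw [← add_mul, ← add_mul, hsum, one_mul]

theorem IsRMeasure.measure_norm_gt_eq_zero {P : Measure (ℝ × ℝ)} [IsFiniteMeasure P]
    (hP : IsRMeasure P) {e : ℝ} (he : 0 < e) : P {x | 3 / 2 + e < ‖x‖} = 0 := by
  have hle (n : ℕ) : P {x | 3 / 2 + e < ‖x‖} ≤ P {x | 3 / 2 + 2 ^ n * e < ‖x‖} := by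
    induction n with
    | zero => simp
    | succ n ih =>
      refine ih.trans ((hP.measure_norm_gt_le _).trans_eq ?_)
      rw [pow_succ', mul_assoc]
  have hanti : Antitone fun n : ℕ => {x : ℝ × ℝ | 3 / 2 + 2 ^ n * e < ‖x‖} := by
    intro m n hmn x hx
    have : (2 : ℝ) ^ m * e ≤ 2 ^ n * e := by gcongr; norm_num
    simp only [mem_ofPred_eq] at hx ⊢
    linarith
  have hempty : ⋂ n : ℕ, {x : ℝ × ℝ | 3 / 2 + 2 ^ n * e < ‖x‖} = ∅ := by
    refine eq_empty_of_forall_notMem fun x hx => ?_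
    obtain ⟨n, hn⟩ := pow_unbounded_of_one_lt (‖x‖ / e) (one_lt_two (α := ℝ))
    rw [div_lt_iff₀ he] at hn
    have := mem_iInter.1 hx n
    simp only [mem_ofPred_eq] at this
    linarith
  have htend := tendsto_measure_iInter_atTop (μ := P)
    (fun n : ℕ => (measurableSet_lt (measurable_const (a := 3 / 2 + 2 ^ n * e))
      (measurable_norm (α := ℝ × ℝ))).nullMeasurableSet) hanti ⟨0, measure_ne_top _ _⟩
  rw [hempty, measure_empty] at htend
  exact le_antisymm (ge_of_tendsto' htend hle) zero_le

theorem IsRMeasure.integrable_id {P : Measure (ℝ × ℝ)} [IsFiniteMeasure P]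
    (hP : IsRMeasure P) : Integrable (fun x => x) P := by
  refine Integrable.of_bound (by fun_prop) (3 / 2 + 1) ?_
  rw [ae_iff]
  simpa only [not_le] using hP.measure_norm_gt_eq_zero one_pos

theorem IsRMeasure.integral_eq {P : Measure (ℝ × ℝ)} (hP : IsRMeasure P) {f : ℝ × ℝ → ℝ}
    (hf : Continuous f) (hi : ∀ i, Integrable (fun x => f (Smap i x)) P) :
    ∫ x, f x ∂P = 1 / 5 * ∫ x, f (Smap 0 x) ∂P + 1 / 5 * ∫ x, f (Smap 1 x) ∂P
      + 3 / 5 * ∫ x, f (Smap 2 x) ∂P := by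
  have hmap (i : Fin 3) : Integrable f (P.map (Smap i)) :=
    (integrable_map_measure hf.aestronglyMeasurable
      (continuous_Smap i).measurable.aemeasurable).2 (hi i)
  have h (i : Fin 3) : ∫ x, f x ∂(P.map (Smap i)) = ∫ x, f (Smap i x) ∂P :=
    integral_map (continuous_Smap i).measurable.aemeasurable hf.aestronglyMeasurable
  have t1 : (1 / 5 : ℝ≥0∞) ≠ ∞ := ENNReal.div_ne_top (by norm_num) (by norm_num)
  have t3 : (3 / 5 : ℝ≥0∞) ≠ ∞ := ENNReal.div_ne_top (by norm_num) (by norm_num)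
  have i0 := (hmap 0).smul_measure t1
  have i1 := (hmap 1).smul_measure t1
  have i2 := (hmap 2).smul_measure t3
  calc ∫ x, f x ∂P = _ := congrArg (fun μ : Measure (ℝ × ℝ) => ∫ x, f x ∂μ) hP
    _ = _ := by
      rw [integral_add_measure (i0.add_measure i1) i2, integral_add_measure i0 i1]
      simp only [integral_smul_measure, h, smul_eq_mul, ENNReal.toReal_div]
      norm_num

/-- `E(X) = (1/2, √3/4)`. -/
theorem stmt_3 (P : Measure (ℝ × ℝ)) [IsProbabilityMeasure P] (hP : IsRMeasure P) :
    (∫ x : ℝ × ℝ, x.1 ∂P) = 1/2 ∧ (∫ x : ℝ × ℝ, x.2 ∂P) = Real.sqrt 3 / 4 := by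
  have h1 : Integrable (fun x : ℝ × ℝ => x.1) P := hP.integrable_id.fst
  have h2 : Integrable (fun x : ℝ × ℝ => x.2) P := hP.integrable_id.snd
  have d1 (c : ℝ) : Integrable (fun x : ℝ × ℝ => x.1 / c) P := h1.div_const c
  have d2 (c : ℝ) : Integrable (fun x : ℝ × ℝ => x.2 / c) P := h2.div_const c
  have c1 (c d : ℝ) : Integrable (fun x : ℝ × ℝ => x.1 / c + d) P :=
    (d1 c).add (integrable_const d)
  have c2 (c d : ℝ) : Integrable (fun x : ℝ × ℝ => x.2 / c + d) P :=
    (d2 c).add (integrable_const d)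
  have e1 (c d : ℝ) : ∫ x : ℝ × ℝ, (x.1 / c + d) ∂P = (∫ x : ℝ × ℝ, x.1 ∂P) / c + d := by
    rw [integral_add (d1 c) (integrable_const d), integral_div]
    simp
  have e2 (c d : ℝ) : ∫ x : ℝ × ℝ, (x.2 / c + d) ∂P = (∫ x : ℝ × ℝ, x.2 ∂P) / c + d := by
    rw [integral_add (d2 c) (integrable_const d), integral_div]
    simp
  have k1 := hP.integral_eq continuous_fst fun i => by
    fin_cases i
    exacts [d1 4, c1 4 (3 / 4), c1 2 (1 / 4)]
  have k2 := hP.integral_eq continuous_snd fun i => by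
    fin_cases i
    exacts [d2 4, d2 4, c2 2 (Real.sqrt 3 / 4)]
  simp only [Smap, Matrix.cons_val, integral_div, e1, e2] at k1 k2
  constructor <;> linarith
end

section
/- For every word ω over {1,2,3} of length k ≥ 1, the conditional expectation of X given X ∈ Δ_ω equals S_ω(1/2, √3/4); that is, ∫_{Δ_ω} x dP(x) = P(Δ_ω) · S_ω(1/2, √3/4). -/
open MeasureTheory Real Set
open scoped ENNReal NNReal

/-- The triangle as an intersection of three half-planes. -/
theorem mem_Δtri_iff (x : ℝ × ℝ) :
    x ∈ Δtri ↔ 0 ≤ x.2 ∧ x.2 ≤ √3 * x.1 ∧ x.2 ≤ √3 * (1 - x.1) := by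
  have h3 : √3 * √3 = 3 := Real.mul_self_sqrt (by norm_num)
  have h0 : 0 < √3 := by positivity
  constructor
  · intro hx
    have hconv : Convex ℝ {x : ℝ × ℝ | 0 ≤ x.2 ∧ x.2 ≤ √3 * x.1 ∧ x.2 ≤ √3 * (1 - x.1)} := by
      rintro x ⟨hx₁, hx₂, hx₃⟩ y ⟨hy₁, hy₂, hy₃⟩ a b ha hb hab
      obtain rfl : b = 1 - a := by linarith
      simp only [mem_ofPred_eq, Prod.snd_add, Prod.smul_snd, Prod.fst_add, Prod.smul_fst,
        smul_eq_mul]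
      refine ⟨by positivity, ?_, ?_⟩
      · linarith [mul_le_mul_of_nonneg_left hx₂ ha, mul_le_mul_of_nonneg_left hy₂ hb]
      · linarith [mul_le_mul_of_nonneg_left hx₃ ha, mul_le_mul_of_nonneg_left hy₃ hb]
    refine convexHull_min ?_ hconv hx
    rintro y (rfl | rfl | rfl)
    · simp
    · simp
    · refine ⟨by positivity, ?_, ?_⟩ <;> dsimp only <;> linarith
  · rintro ⟨h₁, h₂, h₃⟩
    have hx : x = ∑ i : Fin 3, ![1 - x.1 - √3 * x.2 / 3, x.1 - √3 * x.2 / 3, 2 * √3 * x.2 / 3] i •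
        (![(0, 0), (1, 0), (1/2, √3 / 2)] : Fin 3 → ℝ × ℝ) i := by
      ext
      · simp [Fin.sum_univ_three]
        ring
      · simp [Fin.sum_univ_three]
        linear_combination (-x.2 / 3) * h3
    rw [hx]
    refine (convex_convexHull ℝ _).sum_mem ?_ ?_ ?_
    · intro i _
      fin_cases i
      · simp
        nlinarith
      · simp
        nlinarith
      · simp
        positivity
    · simp [Fin.sum_univ_three]
      ring
    · intro i _
      refine subset_convexHull ℝ _ ?_
      fin_cases i <;> simp

theorem isCompact_Δtri : IsCompact Δtri :=
  (Set.toFinite _).isCompact_convexHull ℝ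

/-- The translation part of `Smap i`. -/
noncomputable def Smap_translation : Fin 3 → ℝ × ℝ := ![(0, 0), (3/4, 0), (1/4, √3 / 4)]

theorem Smap_eq (i : Fin 3) (x : ℝ × ℝ) : Smap i x = sr i • x + Smap_translation i := by
  fin_cases i <;> ext <;> simp [Smap, sr, Smap_translation] <;> ring

theorem sr_pos (i : Fin 3) : 0 < sr i := by
  fin_cases i <;> simp [sr]

theorem pr_pos (i : Fin 3) : 0 < pr i := by
  fin_cases i <;> simp [pr]

theorem measurable_Smap (i : Fin 3) : Measurable (Smap i) :=
  (continuous_Smap i).measurable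

theorem injective_Smap (i : Fin 3) : Function.Injective (Smap i) := by
  intro x y h
  rw [Smap_eq, Smap_eq] at h
  exact smul_right_injective _ (sr_pos i).ne' (add_right_cancel h)

theorem Smap_mem_Δtri (i : Fin 3) {x : ℝ × ℝ} (hx : x ∈ Δtri) : Smap i x ∈ Δtri := by
  have h0 : 0 < √3 := by positivity
  rw [mem_Δtri_iff] at hx ⊢
  obtain ⟨h₁, h₂, h₃⟩ := hx
  fin_cases i <;> simp [Smap] <;> refine ⟨by positivity, ?_, ?_⟩ <;> linarith

theorem Smap_ne_Smap {i j : Fin 3} (hij : j ≠ i) {x y : ℝ × ℝ} (hx : x ∈ Δtri) (hy : y ∈ Δtri) :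
    Smap i x ≠ Smap j y := by
  have h0 : 0 < √3 := by positivity
  rw [mem_Δtri_iff] at hx hy
  obtain ⟨hx₁, hx₂, hx₃⟩ := hx
  obtain ⟨hy₁, hy₂, hy₃⟩ := hy
  have hx₄ : 0 ≤ x.1 := by by_contra! h; nlinarith
  have hy₄ : 0 ≤ y.1 := by by_contra! h; nlinarith
  have hx₅ : x.1 ≤ 1 := by by_contra! h; nlinarith
  have hy₅ : y.1 ≤ 1 := by by_contra! h; nlinarith
  intro h
  rw [Prod.ext_iff] at h
  obtain ⟨h₁, h₂⟩ := h
  fin_cases i <;> fin_cases j <;> simp [Smap] at hij h₁ h₂ <;> linarith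

theorem IsRMeasure.eq_sum {P : Measure (ℝ × ℝ)} (hP : IsRMeasure P) :
    P = ∑ i, ENNReal.ofReal (pr i) • P.map (Smap i) := by
  have h₁ : ENNReal.ofReal (1/5) = 1/5 := by
    rw [ENNReal.ofReal_div_of_pos (by norm_num)]; simp
  have h₂ : ENNReal.ofReal (3/5) = 3/5 := by
    rw [ENNReal.ofReal_div_of_pos (by norm_num)]; simp
  conv_lhs => rw [hP]
  rw [Fin.sum_univ_three]
  simp only [pr, Matrix.cons_val, h₁, h₂]

theorem IsRMeasure.apply {P : Measure (ℝ × ℝ)} (hP : IsRMeasure P) {A : Set (ℝ × ℝ)}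
    (hA : MeasurableSet A) : P A = ∑ i, ENNReal.ofReal (pr i) * P (Smap i ⁻¹' A) := by
  conv_lhs => rw [hP.eq_sum]
  simp [Measure.map_apply (measurable_Smap _) hA]

theorem sum_ofReal_pr : ∑ i, ENNReal.ofReal (pr i) = 1 := by
  rw [← ENNReal.ofReal_sum_of_nonneg fun i _ => (pr_pos i).le, Fin.sum_univ_three]
  simp [pr]
  norm_num

/-- A function whose positive part is halved by each `Smap i` is a.e. nonpositive. -/
theorem IsRMeasure.ae_nonpos {P : Measure (ℝ × ℝ)} [IsProbabilityMeasure P] (hP : IsRMeasure P)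
    {g : ℝ × ℝ → ℝ} (hg : Measurable g) (h : ∀ i x, g (Smap i x) ≤ max 0 (g x) / 2) :
    ∀ᵐ x ∂P, g x ≤ 0 := by
  have hmeas (t : ℝ) : MeasurableSet {x | t < g x} := measurableSet_lt measurable_const hg
  have hstep (t : ℝ) (ht : 0 < t) : P {x | t < g x} ≤ P {x | 2 * t < g x} := by
    rw [hP.apply (hmeas t), ← one_mul (P {x | 2 * t < g x}), ← sum_ofReal_pr, Finset.sum_mul]
    gcongr with i
    intro x hx
    have h₁ : t < g (Smap i x) := hx
    have h₂ : 2 * t < max 0 (g x) := by linarith [h i x]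
    rcases lt_max_iff.1 h₂ with h₃ | h₃
    · linarith
    · exact h₃
  have hiter (t : ℝ) (ht : 0 < t) (n : ℕ) : P {x | t < g x} ≤ P {x | 2 ^ n * t < g x} := by
    induction n with
    | zero => simp
    | succ n ih =>
      refine ih.trans ((hstep _ (by positivity)).trans_eq ?_)
      rw [pow_succ', mul_assoc]
  have hzero (t : ℝ) (ht : 0 < t) : P {x | t < g x} = 0 := by
    have hanti : Antitone fun n : ℕ => {x | 2 ^ n * t < g x} := by
      intro m n hmn x hx
      refine lt_of_le_of_lt ?_ (mem_ofPred_eq ▸ hx)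
      gcongr
      norm_num
    have hlim := tendsto_measure_iInter_atTop (μ := P)
      (fun n => (hmeas (2 ^ n * t)).nullMeasurableSet) hanti ⟨0, measure_ne_top _ _⟩
    have hempty : ⋂ n : ℕ, {x | 2 ^ n * t < g x} = ∅ := by
      refine eq_empty_of_forall_notMem fun x hx => ?_
      obtain ⟨n, hn⟩ := pow_unbounded_of_one_lt (g x / t) one_lt_two
      have := mem_iInter.1 hx n
      rw [div_lt_iff₀ ht] at hn
      exact lt_asymm hn this
    rw [hempty, measure_empty] at hlim
    exact le_antisymm (ge_of_tendsto' hlim (hiter t ht)) zero_le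
  have hall : ∀ᵐ x ∂P, ∀ n : ℕ, g x ≤ 1 / ((n : ℝ) + 1) := by
    refine ae_all_iff.2 fun n => ?_
    simpa [ae_iff] using hzero (1 / ((n : ℝ) + 1)) (by positivity)
  filter_upwards [hall] with x hx
  exact ge_of_tendsto' tendsto_one_div_add_atTop_nhds_zero_nat hx

theorem IsRMeasure.ae_mem_Δtri {P : Measure (ℝ × ℝ)} [IsProbabilityMeasure P]
    (hP : IsRMeasure P) : ∀ᵐ x ∂P, x ∈ Δtri := by
  have h0 : 0 < √3 := by positivity
  have h₁ : ∀ᵐ x ∂P, -x.2 ≤ 0 := by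
    refine hP.ae_nonpos (by fun_prop) fun i x => ?_
    have := le_max_left 0 (-x.2)
    have := le_max_right 0 (-x.2)
    fin_cases i <;> simp only [Smap, Fin.zero_eta, Fin.mk_one, Fin.reduceFinMk, Matrix.cons_val] <;>
      linarith
  have h₂ : ∀ᵐ x ∂P, x.2 - √3 * x.1 ≤ 0 := by
    refine hP.ae_nonpos (by fun_prop) fun i x => ?_
    have := le_max_left 0 (x.2 - √3 * x.1)
    have := le_max_right 0 (x.2 - √3 * x.1)
    fin_cases i <;> simp only [Smap, Fin.zero_eta, Fin.mk_one, Fin.reduceFinMk, Matrix.cons_val] <;>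
      linarith
  have h₃ : ∀ᵐ x ∂P, x.2 - √3 * (1 - x.1) ≤ 0 := by
    refine hP.ae_nonpos (by fun_prop) fun i x => ?_
    have := le_max_left 0 (x.2 - √3 * (1 - x.1))
    have := le_max_right 0 (x.2 - √3 * (1 - x.1))
    fin_cases i <;> simp only [Smap, Fin.zero_eta, Fin.mk_one, Fin.reduceFinMk, Matrix.cons_val] <;>
      linarith
  filter_upwards [h₁, h₂, h₃] with x hx₁ hx₂ hx₃
  rw [mem_Δtri_iff]
  exact ⟨by linarith, by linarith, by linarith⟩

/-- Self-similarity of the R-measure on each first-level triangle. -/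
theorem IsRMeasure.restrict_image {P : Measure (ℝ × ℝ)} [IsProbabilityMeasure P]
    (hP : IsRMeasure P) (i : Fin 3) {B : Set (ℝ × ℝ)} (hB : IsCompact B) (hBΔ : B ⊆ Δtri) :
    P.restrict (Smap i '' B) = ENNReal.ofReal (pr i) • (P.restrict B).map (Smap i) := by
  ext A hA
  have hB' : MeasurableSet (Smap i '' B) := (hB.image (continuous_Smap i)).measurableSet
  rw [Measure.restrict_apply hA, hP.apply (hA.inter hB'), Finset.sum_eq_single i]
  · rw [Measure.smul_apply, smul_eq_mul, Measure.map_apply (measurable_Smap i) hA,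
      Measure.restrict_apply (measurable_Smap i hA), preimage_inter,
      preimage_image_eq _ (injective_Smap i)]
  · intro j _ hji
    have hnull : P (Smap j ⁻¹' (A ∩ Smap i '' B)) = 0 := by
      refine measure_mono_null ?_ (ae_iff.1 hP.ae_mem_Δtri)
      rintro y ⟨-, x, hx, hxy⟩ hy
      exact Smap_ne_Smap hji (hBΔ hx) hy hxy
    rw [hnull, mul_zero]
  · simp

theorem integral_map_Smap {μ : Measure (ℝ × ℝ)} [IsFiniteMeasure μ]
    (hμ : Integrable (fun x => x) μ) (i : Fin 3) :
    ∫ x, x ∂μ.map (Smap i) = sr i • ∫ x, x ∂μ + μ.real univ • Smap_translation i := by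
  rw [integral_map (measurable_Smap i).aemeasurable (by fun_prop)]
  simp_rw [Smap_eq]
  rw [integral_add (hμ.fun_smul (sr i)) (integrable_const _), integral_const, integral_smul]

theorem IsRMeasure.integrable {P : Measure (ℝ × ℝ)} [IsProbabilityMeasure P]
    (hP : IsRMeasure P) : Integrable (fun x => x) P := by
  rw [← Measure.restrict_eq_self_of_ae_mem hP.ae_mem_Δtri]
  exact continuous_id.continuousOn.integrableOn_compact isCompact_Δtri

theorem IsRMeasure.integral_eq_s7 {P : Measure (ℝ × ℝ)} [IsProbabilityMeasure P]
    (hP : IsRMeasure P) : ∫ x, x ∂P = (1/2, √3 / 4) := by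
  have hint (i : Fin 3) : Integrable (fun x => x) (ENNReal.ofReal (pr i) • P.map (Smap i)) := by
    refine Integrable.smul_measure ?_ ENNReal.ofReal_ne_top
    rw [integrable_map_measure (by fun_prop) (measurable_Smap i).aemeasurable]
    simp only [Function.comp_def, Smap_eq]
    exact (hP.integrable.smul (sr i)).add (integrable_const _)
  have hmean : ∫ x, x ∂P = ∑ i, pr i • (sr i • ∫ x, x ∂P + Smap_translation i) := by
    conv_lhs => rw [hP.eq_sum, integral_finsetSum_measure fun i _ => hint i]
    refine Finset.sum_congr rfl fun i _ => ?_
    rw [integral_smul_measure, ENNReal.toReal_ofReal (pr_pos i).le,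
      integral_map_Smap hP.integrable, probReal_univ, one_smul]
  obtain ⟨h₁, h₂⟩ := Prod.ext_iff.1 hmean
  simp [Fin.sum_univ_three, pr, sr, Smap_translation] at h₁ h₂
  ext <;> dsimp only <;> linarith

theorem Sw_cons (i : Fin 3) (ω : List (Fin 3)) : Sw (i :: ω) = Smap i ∘ Sw ω := rfl

theorem continuous_Sw (ω : List (Fin 3)) : Continuous (Sw ω) := by
  induction ω with
  | nil => exact continuous_id
  | cons i ω ih => exact (continuous_Smap i).comp ih

theorem Sw_image_subset (ω : List (Fin 3)) : Sw ω '' Δtri ⊆ Δtri := by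
  induction ω with
  | nil => simp [Sw]
  | cons i ω ih =>
    rw [Sw_cons, image_comp]
    rintro _ ⟨x, hx, rfl⟩
    exact Smap_mem_Δtri i (ih hx)

theorem IsRMeasure.setIntegral_Sw_image {P : Measure (ℝ × ℝ)} [IsProbabilityMeasure P]
    (hP : IsRMeasure P) (ω : List (Fin 3)) :
    ∫ x in Sw ω '' Δtri, x ∂P = P.real (Sw ω '' Δtri) • Sw ω (1/2, √3 / 4) := by
  induction ω with
  | nil =>
    have hΔ : P.real Δtri = 1 := by
      rw [measureReal_def, (prob_compl_eq_zero_iff isCompact_Δtri.measurableSet).1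
        (ae_iff.1 hP.ae_mem_Δtri), ENNReal.toReal_one]
    simp only [Sw, List.map_nil, List.foldr_nil, image_id, id_eq]
    rw [Measure.restrict_eq_self_of_ae_mem hP.ae_mem_Δtri, hP.integral_eq_s7, hΔ, one_smul]
  | cons i ω ih =>
    have hrestrict := hP.restrict_image i (isCompact_Δtri.image (continuous_Sw ω))
      (Sw_image_subset ω)
    have hreal : P.real (Smap i '' (Sw ω '' Δtri)) = pr i * P.real (Sw ω '' Δtri) := by
      rw [← measureReal_restrict_apply_univ, hrestrict, measureReal_ennreal_smul_apply,
        ENNReal.toReal_ofReal (pr_pos i).le, map_measureReal_apply (measurable_Smap i) .univ,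
        preimage_univ, measureReal_restrict_apply_univ]
    rw [Sw_cons, image_comp, hreal, hrestrict, integral_smul_measure,
      ENNReal.toReal_ofReal (pr_pos i).le,
      integral_map_Smap hP.integrable.restrict, ih, measureReal_restrict_apply_univ,
      Function.comp_apply, Smap_eq]
    module

/-- For a word ω of length k ≥ 1, `∫_{Δ_ω} x dP(x) = P(Δ_ω) · S_ω(1/2, √3/4)`. -/
theorem stmt_7 (P : Measure (ℝ × ℝ)) [IsProbabilityMeasure P] (hP : IsRMeasure P)
    (ω : List (Fin 3)) (hω : 1 ≤ ω.length) :
    (∫ x in Sw ω '' Δtri, x ∂P) =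
      (P (Sw ω '' Δtri)).toReal • Sw ω (1/2, Real.sqrt 3 / 4) := by
  exact hP.setIntegral_Sw_image ω
end
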